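/- Fix an integer n ≥ 2, nonnegative integers ν and k with k ≥ 1, a real σ_0 > 0, a real Λ > σ_0, a function f ∈ C_c^∞((0, ∞)), and y ≥ 1. With Ω_{ν,k}(y) = (1/2πi)∫_{(−σ_0)} (∫_0^∞ f(x)·x^{s−1} dx) · π^{−n/2} · n^{ns − n/2} · [Γ((1 − ns)/2) / Γ((ns+1)/2 + ν − n/2)] · (s + Λ)^{−k} · y^{s} ds, one has the recursion formula Ω_{ν,k}(y) = (n/2)·Ω_{ν+1,k−1}(y) + (1/2 + ν − n/2 − nΛ/2)·Ω_{ν+1,k}(y). -/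

import Mathlib

open Complex Real MeasureTheory

/-- The integral transform
`Ω_{ν,k}(y) = (1/2πi) ∫_{(-σ₀)} (∫_0^∞ f(x) x^{s-1} dx) π^{-n/2} n^{ns-n/2}
  [Γ((1-ns)/2)/Γ((ns+1)/2+ν-n/2)] (s+Λ)^{-k} y^s ds`. -/
noncomputable def omegaNuK (n ν k : ℕ) (Λ σ₀ : ℝ) (f : ℝ → ℂ) (y : ℝ) : ℂ :=
  (1 / (2 * (Real.pi : ℂ))) * ∫ t : ℝ,
    (∫ x in Set.Ioi (0 : ℝ), f x * (x : ℂ) ^ ((-(σ₀ : ℂ) + t * Complex.I) - 1)) *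
      (Real.pi : ℂ) ^ (-(n : ℂ) / 2) *
      (n : ℂ) ^ ((n : ℂ) * (-(σ₀ : ℂ) + t * Complex.I) - (n : ℂ) / 2) *
      (Complex.Gamma ((1 - (n : ℂ) * (-(σ₀ : ℂ) + t * Complex.I)) / 2) /
        Complex.Gamma (((n : ℂ) * (-(σ₀ : ℂ) + t * Complex.I) + 1) / 2 +
          (ν : ℂ) - (n : ℂ) / 2)) *
      ((-(σ₀ : ℂ) + t * Complex.I) + (Λ : ℂ)) ^ (-(k : ℤ)) *
      (y : ℂ) ^ (-(σ₀ : ℂ) + t * Complex.I)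

open scoped FourierTransform SchwartzMap ContDiff

lemma norm_beta_le (a c : ℝ) (τ : ℝ) :
    ‖Complex.betaIntegral (a + τ * I) c‖ ≤
      ∫ x in (0:ℝ)..1, ‖(x : ℂ) ^ ((a : ℂ) - 1) * (1 - (x : ℂ)) ^ ((c : ℂ) - 1)‖ := by
  unfold Complex.betaIntegral
  refine (intervalIntegral.norm_integral_le_integral_norm zero_le_one).trans (le_of_eq ?_)
  refine intervalIntegral.integral_congr_ae (Filter.Eventually.of_forall fun x hx => ?_)
  rw [Set.uIoc_of_le zero_le_one] at hx
  rw [norm_mul, norm_mul, Complex.norm_cpow_eq_rpow_re_of_pos hx.1,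
    Complex.norm_cpow_eq_rpow_re_of_pos hx.1]
  simp

lemma gamma_ratio_bound (a : ℝ) (ha : 0 < a) (N : ℕ) : ∀ b : ℝ, a < b + N →
    ∃ C : ℝ, 0 ≤ C ∧ ∃ M : ℕ, ∀ τ : ℝ,
      ‖Complex.Gamma (a + τ * I)‖ * ‖(Complex.Gamma (b + τ * I))⁻¹‖ ≤ C * (1 + |τ|) ^ M := by
  induction N with
  | zero =>
    intro b hb
    have hc : 0 < b - a := by simpa using hb
    set J := ∫ x in (0:ℝ)..1, ‖(x : ℂ) ^ ((a : ℂ) - 1) * (1 - (x : ℂ)) ^ (((b - a : ℝ) : ℂ) - 1)‖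
      with hJ
    have hG : Complex.Gamma ((b - a : ℝ) : ℂ) ≠ 0 :=
      Complex.Gamma_ne_zero_of_re_pos (by simpa using hc)
    have hJ0 : 0 ≤ J := (norm_nonneg _).trans (norm_beta_le a (b - a) 0)
    refine ⟨J / ‖Complex.Gamma ((b - a : ℝ) : ℂ)‖, by positivity, 0, fun τ => ?_⟩
    have h1 := Complex.Gamma_mul_Gamma_eq_betaIntegral (s := a + τ * I) (t := ((b - a : ℝ) : ℂ))
      (by simpa using ha) (by simpa using hc)
    have e : (a + τ * I : ℂ) + ((b - a : ℝ) : ℂ) = b + τ * I := by push_cast; ring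
    rw [e] at h1
    have hB : Complex.Gamma (b + τ * I) ≠ 0 :=
      Complex.Gamma_ne_zero_of_re_pos (by simp; linarith)
    have h2 := norm_beta_le a (b - a) τ
    rw [pow_zero, mul_one, le_div_iff₀ (norm_pos_iff.2 hG), mul_right_comm, ← norm_mul, h1,
      ← norm_mul, mul_right_comm, mul_inv_cancel₀ hB, one_mul]
    exact h2
  | succ N ih =>
    intro b hb
    obtain ⟨C, hC, M, h⟩ := ih (b + 1) (by push_cast at hb; linarith)
    refine ⟨C * (|b| + 1), by positivity, M + 1, fun τ => ?_⟩
    have e : (b + τ * I : ℂ) + 1 = ((b + 1 : ℝ) : ℂ) + τ * I := by push_cast; ring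
    rw [Complex.one_div_Gamma_eq_self_mul_one_div_Gamma_add_one, e, norm_mul]
    have h3 : ‖(b + τ * I : ℂ)‖ ≤ (|b| + 1) * (1 + |τ|) := by
      refine (norm_add_le _ _).trans ?_
      simp only [norm_mul, Complex.norm_real, Complex.norm_I, Real.norm_eq_abs, mul_one]
      nlinarith [abs_nonneg b, abs_nonneg τ]
    calc _ = ‖(b + τ * I : ℂ)‖ * (‖Complex.Gamma (a + τ * I)‖ *
            ‖(Complex.Gamma (((b + 1 : ℝ) : ℂ) + τ * I))⁻¹‖) := by ring
      _ ≤ ((|b| + 1) * (1 + |τ|)) * (C * (1 + |τ|) ^ M) := 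
        mul_le_mul h3 (h τ) (by positivity) (by positivity)
      _ = _ := by ring

lemma mellin_schwartz (σ₀ : ℝ) (f : ℝ → ℂ) (hf : ContDiff ℝ (⊤ : ℕ∞) f)
    (hfc : HasCompactSupport f) (hfs : tsupport f ⊆ Set.Ioi 0) :
    ∃ g : 𝓢(ℝ, ℂ), ∀ t : ℝ,
      (∫ x in Set.Ioi (0 : ℝ), f x * (x : ℂ) ^ ((-(σ₀ : ℂ) + t * Complex.I) - 1)) =
        g (t / (2 * π)) := by
  let h : ℝ → ℂ := fun u => Real.exp (σ₀ * u) • f (Real.exp (-u))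
  have h1 : HasCompactSupport h := by
    have hK : IsCompact ((fun x => -Real.log x) '' tsupport f) := by
      refine IsCompact.image_of_continuousOn hfc ?_
      refine (Real.continuousOn_log.mono fun x hx => ?_).neg
      exact (ne_of_gt (hfs hx) : x ≠ 0)
    refine HasCompactSupport.intro hK fun u hu => ?_
    have : f (Real.exp (-u)) = 0 := by
      by_contra hne
      exact hu ⟨Real.exp (-u), subset_tsupport _ hne, by simp⟩
    simp [h, this]
  have h2 : ContDiff ℝ ∞ h := by
    have : ContDiff ℝ ∞ f := hf
    fun_prop
  refine ⟨𝓕 (h1.toSchwartzMap h2), fun t => ?_⟩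
  have := mellin_eq_fourier f (s := -(σ₀ : ℂ) + t * I)
  rw [mellin] at this
  simp only [smul_eq_mul] at this
  simp_rw [mul_comm (f _)]
  rw [this, SchwartzMap.fourier_coe]
  simp [h]
  rfl

lemma omega_integrable (n : ℕ) (hn : 2 ≤ n) (ν k : ℕ)
    (σ₀ Λ : ℝ) (hσ₀ : 0 < σ₀) (hΛ : σ₀ < Λ)
    (f : ℝ → ℂ) (hf : ContDiff ℝ (⊤ : ℕ∞) f) (hfc : HasCompactSupport f)
    (hfs : tsupport f ⊆ Set.Ioi 0) (y : ℝ) (hy : 1 ≤ y) :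
    Integrable (fun t : ℝ =>
    (∫ x in Set.Ioi (0 : ℝ), f x * (x : ℂ) ^ ((-(σ₀ : ℂ) + t * Complex.I) - 1)) *
      (Real.pi : ℂ) ^ (-(n : ℂ) / 2) *
      (n : ℂ) ^ ((n : ℂ) * (-(σ₀ : ℂ) + t * Complex.I) - (n : ℂ) / 2) *
      (Complex.Gamma ((1 - (n : ℂ) * (-(σ₀ : ℂ) + t * Complex.I)) / 2) /
        Complex.Gamma (((n : ℂ) * (-(σ₀ : ℂ) + t * Complex.I) + 1) / 2 +
          (ν : ℂ) - (n : ℂ) / 2)) *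
      ((-(σ₀ : ℂ) + t * Complex.I) + (Λ : ℂ)) ^ (-(k : ℤ)) *
      (y : ℂ) ^ (-(σ₀ : ℂ) + t * Complex.I)) := by
  obtain ⟨g, hg⟩ := mellin_schwartz σ₀ f hf hfc hfs
  simp only [hg]
  have hn0 : (0:ℝ) < n := by positivity
  have hnC : (n : ℂ) ≠ 0 := by exact_mod_cast hn0.ne'
  have hy0 : 0 < y := by linarith
  have hyC : (y : ℂ) ≠ 0 := by exact_mod_cast hy0.ne'
  set a : ℝ := (1 + n * σ₀) / 2 with ha_def
  have ha : 0 < a := by positivity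
  set b : ℝ := (1 - n * σ₀) / 2 + ν - n / 2 with hb_def
  have ea : ∀ t : ℝ, (1 - (n : ℂ) * (-(σ₀ : ℂ) + t * Complex.I)) / 2
      = (starRingEnd ℂ) ((a : ℂ) + ((n * t / 2 : ℝ) : ℂ) * I) := by
    intro t
    simp only [map_add, map_mul, Complex.conj_ofReal, Complex.conj_I, ha_def]
    push_cast; ring
  have eb : ∀ t : ℝ, ((n : ℂ) * (-(σ₀ : ℂ) + t * Complex.I) + 1) / 2 + (ν : ℂ) - (n : ℂ) / 2
      = (b : ℂ) + ((n * t / 2 : ℝ) : ℂ) * I := by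
    intro t
    simp only [hb_def]
    push_cast; ring
  have hsl : ∀ t : ℝ, Λ - σ₀ ≤ ‖(-(σ₀ : ℂ) + t * Complex.I) + (Λ : ℂ)‖ := by
    intro t
    refine le_trans ?_ (Complex.re_le_norm _)
    simp
    try linarith
  have hsl0 : 0 < Λ - σ₀ := by linarith
  obtain ⟨N, hN⟩ := exists_nat_gt (a - b)
  obtain ⟨C, hC, M, hM⟩ := gamma_ratio_bound a ha N b (by linarith)
  -- continuity
  have hcont : Continuous (fun t : ℝ =>
      g (t / (2 * π)) *
      (Real.pi : ℂ) ^ (-(n : ℂ) / 2) *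
      (n : ℂ) ^ ((n : ℂ) * (-(σ₀ : ℂ) + t * Complex.I) - (n : ℂ) / 2) *
      (Complex.Gamma ((1 - (n : ℂ) * (-(σ₀ : ℂ) + t * Complex.I)) / 2) /
        Complex.Gamma (((n : ℂ) * (-(σ₀ : ℂ) + t * Complex.I) + 1) / 2 +
          (ν : ℂ) - (n : ℂ) / 2)) *
      ((-(σ₀ : ℂ) + t * Complex.I) + (Λ : ℂ)) ^ (-(k : ℤ)) *
      (y : ℂ) ^ (-(σ₀ : ℂ) + t * Complex.I)) := by
    have c1 : Continuous fun t : ℝ => g (t / (2 * π)) := g.continuous.comp (by fun_prop)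
    have c2 : Continuous fun t : ℝ =>
        (n : ℂ) ^ ((n : ℂ) * (-(σ₀ : ℂ) + t * Complex.I) - (n : ℂ) / 2) :=
      Continuous.const_cpow (by fun_prop) (Or.inl hnC)
    have c3 : Continuous fun t : ℝ =>
        Complex.Gamma ((1 - (n : ℂ) * (-(σ₀ : ℂ) + t * Complex.I)) / 2) := by
      refine continuous_iff_continuousAt.2 fun t => ?_
      refine ContinuousAt.comp (f := fun t : ℝ => (1 - (n : ℂ) * (-(σ₀ : ℂ) + t * Complex.I)) / 2)
        (g := Complex.Gamma) ?_ (by fun_prop)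
      refine (Complex.differentiableAt_Gamma _ fun m hm => ?_).continuousAt
      have := congrArg Complex.re hm
      rw [ea, Complex.conj_re, Complex.add_re, Complex.re_ofReal_mul, Complex.I_re,
        Complex.ofReal_re, Complex.neg_re, Complex.natCast_re] at this
      have : (0:ℝ) ≤ m := by positivity
      linarith
    have c4 : Continuous fun t : ℝ =>
        (Complex.Gamma (((n : ℂ) * (-(σ₀ : ℂ) + t * Complex.I) + 1) / 2 +
          (ν : ℂ) - (n : ℂ) / 2))⁻¹ :=
      Complex.differentiable_one_div_Gamma.continuous.comp
        (f := fun t : ℝ => ((n : ℂ) * (-(σ₀ : ℂ) + t * Complex.I) + 1) / 2 +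
          (ν : ℂ) - (n : ℂ) / 2) (by fun_prop)
    have c5 : Continuous fun t : ℝ =>
        ((-(σ₀ : ℂ) + t * Complex.I) + (Λ : ℂ)) ^ (-(k : ℤ)) := by
      refine Continuous.zpow₀ (by fun_prop) _ fun t => Or.inl ?_
      exact norm_pos_iff.1 (hsl0.trans_le (hsl t))
    have c6 : Continuous fun t : ℝ => (y : ℂ) ^ (-(σ₀ : ℂ) + t * Complex.I) :=
      Continuous.const_cpow (by fun_prop) (Or.inl hyC)
    simp only [div_eq_mul_inv] at c1 c2 c3 c4 c5 c6 ⊢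
    exact ((((c1.mul continuous_const).mul c2).mul (c3.mul c4)).mul c5).mul c6
  -- decay of g
  obtain ⟨D, hD⟩ : ∃ D : ℝ, ∀ x : ℝ, (1 + ‖x‖) ^ (M + 2) * ‖g x‖ ≤ D := by
    refine ⟨2 ^ (M + 2) * (Finset.Iic (M + 2, 0)).sup
      (fun m => SchwartzMap.seminorm ℝ m.1 m.2) g, fun x => ?_⟩
    have := SchwartzMap.one_add_le_sup_seminorm_apply (𝕜 := ℝ) (m := (M + 2, 0))
      (k := M + 2) (n := 0) le_rfl le_rfl g x
    simpa only [norm_iteratedFDeriv_zero] using this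
  have hD0 : 0 ≤ D := le_trans (by positivity) (hD 0)
  set P : ℝ := ‖(Real.pi : ℂ) ^ (-(n : ℂ) / 2)‖
  set Q : ℝ := (n : ℝ) ^ (-(n * σ₀) - n / 2 : ℝ)
  set Y : ℝ := y ^ (-σ₀)
  have hQ : 0 ≤ Q := by positivity
  have hY : 0 ≤ Y := by positivity
  refine Integrable.mono' (g := fun t : ℝ =>
    (D * (2 * π) ^ (M + 2) * P * Q * (C * (1 + n) ^ M) * ((Λ - σ₀)⁻¹) ^ k * Y) * (1 + t ^ 2)⁻¹)
    (integrable_inv_one_add_sq.const_mul _) hcont.aestronglyMeasurable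
    (Filter.Eventually.of_forall fun t => ?_)
  have b1 : ‖g (t / (2 * π))‖ ≤ D * (2 * π) ^ (M + 2) * ((1 + |t|) ^ (M + 2))⁻¹ := by
    have hp : 1 + |t| ≤ (2 * π) * (1 + ‖t / (2 * π)‖) := by
      have h2 : (1:ℝ) ≤ 2 * π := by linarith [Real.pi_gt_three]
      rw [norm_div, Real.norm_eq_abs, Real.norm_of_nonneg (by positivity : 0 ≤ 2 * π), mul_add,
        mul_div_cancel₀ _ (by positivity)]
      linarith
    rw [← div_eq_mul_inv, le_div_iff₀ (by positivity)]
    calc _ ≤ ‖g (t / (2 * π))‖ * ((2 * π) * (1 + ‖t / (2 * π)‖)) ^ (M + 2) := by gcongr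
      _ = ((1 + ‖t / (2 * π)‖) ^ (M + 2) * ‖g (t / (2 * π))‖) * (2 * π) ^ (M + 2) := by
        rw [mul_pow]; ring
      _ ≤ _ := by gcongr; exact hD _
  have b2 : ‖(n : ℂ) ^ ((n : ℂ) * (-(σ₀ : ℂ) + t * Complex.I) - (n : ℂ) / 2)‖ = Q := by
    have := Complex.norm_cpow_eq_rpow_re_of_pos hn0
      ((n : ℂ) * (-(σ₀ : ℂ) + t * Complex.I) - (n : ℂ) / 2)
    rw [Complex.ofReal_natCast] at this
    rw [this]
    simp [Q]
  have b3 : ‖Complex.Gamma ((1 - (n : ℂ) * (-(σ₀ : ℂ) + t * Complex.I)) / 2) /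
        Complex.Gamma (((n : ℂ) * (-(σ₀ : ℂ) + t * Complex.I) + 1) / 2 +
          (ν : ℂ) - (n : ℂ) / 2)‖ ≤ C * (1 + n) ^ M * (1 + |t|) ^ M := by
    rw [ea, eb, Complex.Gamma_conj, div_eq_mul_inv, norm_mul, RCLike.norm_conj]
    refine (hM _).trans ?_
    rw [mul_assoc, ← mul_pow]
    have : |(n * t / 2 : ℝ)| = n * |t| / 2 := by
      rw [abs_div, abs_mul, abs_of_pos hn0, abs_two]
    rw [this]
    gcongr
    nlinarith [abs_nonneg t, mul_nonneg hn0.le (abs_nonneg t)]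
  have b4 : ‖((-(σ₀ : ℂ) + t * Complex.I) + (Λ : ℂ)) ^ (-(k : ℤ))‖ ≤ ((Λ - σ₀)⁻¹) ^ k := by
    rw [zpow_neg, zpow_natCast, norm_inv, norm_pow, ← inv_pow]
    gcongr
    exact hsl t
  have b5 : ‖(y : ℂ) ^ (-(σ₀ : ℂ) + t * Complex.I)‖ = Y := by
    rw [Complex.norm_cpow_eq_rpow_re_of_pos hy0]
    simp [Y]
  have hk0 : 0 ≤ ((Λ - σ₀)⁻¹) ^ k := by positivity
  have b6 : ((1 + |t|) ^ 2)⁻¹ ≤ (1 + t ^ 2)⁻¹ := by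
    gcongr
    nlinarith [abs_nonneg t, sq_abs t]
  rw [norm_mul, norm_mul, norm_mul, norm_mul, norm_mul, b2, b5]
  calc _ ≤ (D * (2 * π) ^ (M + 2) * ((1 + |t|) ^ (M + 2))⁻¹) * P * Q *
        (C * (1 + n) ^ M * (1 + |t|) ^ M) * ((Λ - σ₀)⁻¹) ^ k * Y := by
        gcongr
    _ = (D * (2 * π) ^ (M + 2) * P * Q * (C * (1 + n) ^ M) * ((Λ - σ₀)⁻¹) ^ k * Y) *
        ((1 + |t|) ^ 2)⁻¹ := by
        have : (1 + |t|) ≠ 0 := by positivity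
        rw [pow_add (1 + |t|)]
        field_simp
    _ ≤ _ := by gcongr

/-- The recursion formula
`Ω_{ν,k}(y) = (n/2) Ω_{ν+1,k-1}(y) + (1/2 + ν - n/2 - nΛ/2) Ω_{ν+1,k}(y)`. -/
theorem omega_nu_k_recursion (n : ℕ) (hn : 2 ≤ n) (ν k : ℕ) (hk : 1 ≤ k)
    (σ₀ Λ : ℝ) (hσ₀ : 0 < σ₀) (hΛ : σ₀ < Λ)
    (f : ℝ → ℂ) (hf : ContDiff ℝ (⊤ : ℕ∞) f) (hfc : HasCompactSupport f)
    (hfs : tsupport f ⊆ Set.Ioi 0) (y : ℝ) (hy : 1 ≤ y) :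
    omegaNuK n ν k Λ σ₀ f y =
      ((n : ℂ) / 2) * omegaNuK n (ν + 1) (k - 1) Λ σ₀ f y +
        (1/2 + (ν : ℂ) - (n : ℂ)/2 - (n : ℂ) * (Λ : ℂ) / 2) *
          omegaNuK n (ν + 1) k Λ σ₀ f y := by
  have i1 := omega_integrable n hn (ν + 1) (k - 1) σ₀ Λ hσ₀ hΛ f hf hfc hfs y hy
  have i2 := omega_integrable n hn (ν + 1) k σ₀ Λ hσ₀ hΛ f hf hfc hfs y hy
  unfold omegaNuK
  rw [mul_left_comm, mul_left_comm (1/2 + (ν : ℂ) - (n : ℂ)/2 - (n : ℂ) * (Λ : ℂ) / 2),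
    ← mul_add]
  congr 1
  rw [← integral_const_mul, ← integral_const_mul,
    ← integral_add (i1.const_mul _) (i2.const_mul _)]
  refine integral_congr_ae (Filter.Eventually.of_forall fun t => ?_)
  dsimp only
  generalize (∫ x in Set.Ioi (0 : ℝ), f x * (x : ℂ) ^ ((-(σ₀ : ℂ) + t * Complex.I) - 1)) = F
  have hs : (-(σ₀ : ℂ) + t * Complex.I) + (Λ : ℂ) ≠ 0 := by
    intro h
    have := congrArg Complex.re h
    simp at this
    linarith
  generalize (-(σ₀ : ℂ) + t * Complex.I) = s at hs ⊢
  obtain ⟨j, rfl⟩ : ∃ j, k = j + 1 := ⟨k - 1, by omega⟩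
  have e : ((n : ℂ) * s + 1) / 2 + ((ν + 1 : ℕ) : ℂ) - (n : ℂ) / 2 =
      (((n : ℂ) * s + 1) / 2 + (ν : ℂ) - (n : ℂ) / 2) + 1 := by push_cast; ring
  have ez : (s + (Λ : ℂ)) ^ (-((j + 1 - 1 : ℕ) : ℤ)) =
      (s + (Λ : ℂ)) * (s + (Λ : ℂ)) ^ (-((j + 1 : ℕ) : ℤ)) := by
    rw [← zpow_one_add₀ hs]
    congr 1
    push_cast
    simp
  rw [e, ez, div_eq_mul_inv (Complex.Gamma _), div_eq_mul_inv (Complex.Gamma _),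
    Complex.one_div_Gamma_eq_self_mul_one_div_Gamma_add_one
      (((n : ℂ) * s + 1) / 2 + (ν : ℂ) - (n : ℂ) / 2)]
  ring
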